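/- If H is a nontrivial normal subgroup of F, then the action of H on (∂F, μ) is conservative: every measurable set W ⊆ ∂F with μ(hW ∩ h′W) = 0 for all h ≠ h′ in H satisfies μ(W) = 0. -/

import Mathlib

open MeasureTheory Filter Topology
open scoped ENNReal symmDiff

noncomputable section

/-- A letter of the alphabet `A ∪ A⁻¹` for the free group on `Fin m`. -/
abbrev Letter (m : ℕ) := Fin m × Bool

/-- The inverse letter. -/
def linv {m : ℕ} (x : Letter m) : Letter m := (x.1, !x.2)

/-- A sequence of letters is reduced if no letter is followed by its inverse. -/
def IsRedSeq {m : ℕ} (ω : ℕ → Letter m) : Prop := ∀ n, ω (n + 1) ≠ linv (ω n)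

/-- The boundary `∂F`: infinite reduced words. -/
abbrev Boundary (m : ℕ) := {ω : ℕ → Letter m // IsRedSeq ω}

/-- Word length of an element of the free group. -/
def wlen {m : ℕ} (g : FreeGroup (Fin m)) : ℕ := g.toWord.length

/-- The truncation `[ω]ₙ`: the group element given by the first `n` letters of `ω`. -/
def trunc {m : ℕ} (ω : Boundary m) (n : ℕ) : FreeGroup (Fin m) :=
  FreeGroup.mk (List.ofFn fun i : Fin n => ω.1 i)

/-- Cylinder set `C_g`. -/
def cylinder {m : ℕ} (g : FreeGroup (Fin m)) : Set (Boundary m) :=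
  {ω | trunc ω (wlen g) = g}

/-- The Gromov product `(g|ω)`: length of the longest common initial segment of the
reduced word of `g` and `ω`. -/
def gromov {m : ℕ} (g : FreeGroup (Fin m)) (ω : Boundary m) : ℕ :=
  sSup {k | ∀ i < k, g.toWord[i]? = some (ω.1 i)}

/-- The Busemann function `b_ω(g) = |g| - 2 (g|ω)`. -/
def busemann {m : ℕ} (g : FreeGroup (Fin m)) (ω : Boundary m) : ℤ :=
  (wlen g : ℤ) - 2 * (gromov g ω : ℤ)

/-- The number of letters cancelled in the free reduction of the concatenation
of a finite word `w` with an infinite reduced word `ω`. -/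
def cancelLen {m : ℕ} (w : List (Letter m)) (ω : ℕ → Letter m) : ℕ :=
  sSup {k | k ≤ w.length ∧ ∀ i < k, w[w.length - 1 - i]? = some (linv (ω i))}

/-- The sequence of letters of the free reduction of (reduced word of `g`) ++ `ω`. -/
def actSeq {m : ℕ} (g : FreeGroup (Fin m)) (ω : Boundary m) (n : ℕ) : Letter m :=
  if h : n < g.toWord.length - cancelLen g.toWord ω.1
  then g.toWord[n]'(by omega)
  else ω.1 (n - (g.toWord.length - cancelLen g.toWord ω.1) + cancelLen g.toWord ω.1)

theorem linv_linv {m : ℕ} (x : Letter m) : linv (linv x) = x := by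
  simp [linv]

theorem toWord_chain {m : ℕ} (g : FreeGroup (Fin m)) {j : ℕ} (hj : j + 1 < g.toWord.length) :
    g.toWord[j + 1]'hj ≠ linv (g.toWord[j]'(by omega)) := by
  intro h
  have hsplit : g.toWord = g.toWord.take j ++
      (g.toWord[j]'(by omega)) :: (g.toWord[j+1]'hj) :: g.toWord.drop (j + 2) := by
    conv_lhs => rw [← List.take_append_drop j g.toWord]
    congr 1
    rw [List.drop_eq_getElem_cons (by omega)]
    congr 1
    rw [List.drop_eq_getElem_cons (by omega)]
  rw [h] at hsplit
  have hred : FreeGroup.reduce g.toWord = g.toWord := FreeGroup.reduce_toWord g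
  exact FreeGroup.reduce.not (by rw [hred, hsplit]; rfl)

theorem cancelLen_spec {m : ℕ} (w : List (Letter m)) (ω : ℕ → Letter m) :
    cancelLen w ω ≤ w.length ∧
      ∀ i < cancelLen w ω, w[w.length - 1 - i]? = some (linv (ω i)) := by
  have : cancelLen w ω ∈
      {k | k ≤ w.length ∧ ∀ i < k, w[w.length - 1 - i]? = some (linv (ω i))} := by
    apply Nat.sSup_mem ⟨0, by simp⟩ ⟨w.length, fun x hx => hx.1⟩
  exact this

theorem cancelLen_max {m : ℕ} (w : List (Letter m)) (ω : ℕ → Letter m)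
    (hlt : cancelLen w ω < w.length) :
    w[w.length - 1 - cancelLen w ω]? ≠ some (linv (ω (cancelLen w ω))) := by
  intro hcon
  have hmem : cancelLen w ω + 1 ∈
      {k | k ≤ w.length ∧ ∀ i < k, w[w.length - 1 - i]? = some (linv (ω i))} := by
    refine ⟨hlt, fun i hi => ?_⟩
    rcases Nat.lt_succ_iff_lt_or_eq.mp hi with h | h
    · exact (cancelLen_spec w ω).2 i h
    · subst h; exact hcon
  have := le_csSup ⟨w.length, fun x hx => hx.1⟩ hmem
  simp only [cancelLen] at this ⊢
  omega

theorem isRedSeq_actSeq {m : ℕ} (g : FreeGroup (Fin m)) (ω : Boundary m) :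
    IsRedSeq (actSeq g ω) := by
  intro n
  obtain ⟨hkle, hcan⟩ := cancelLen_spec g.toWord ω.1
  by_cases h1 : n + 1 < g.toWord.length - cancelLen g.toWord ω.1
  · have h0 : n < g.toWord.length - cancelLen g.toWord ω.1 := by omega
    rw [show actSeq g ω (n + 1) = g.toWord[n + 1]'(by omega) from dif_pos h1,
        show actSeq g ω n = g.toWord[n]'(by omega) from dif_pos h0]
    exact toWord_chain g (by omega)
  · by_cases h0 : n < g.toWord.length - cancelLen g.toWord ω.1
    · have hklt : cancelLen g.toWord ω.1 < g.toWord.length := by omega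
      have hidx : n = g.toWord.length - 1 - cancelLen g.toWord ω.1 := by omega
      have e0 : actSeq g ω n = g.toWord[n]'(by omega) := dif_pos h0
      have e1 : actSeq g ω (n + 1) =
          ω.1 (n + 1 - (g.toWord.length - cancelLen g.toWord ω.1) +
            cancelLen g.toWord ω.1) := dif_neg h1
      have harg : n + 1 - (g.toWord.length - cancelLen g.toWord ω.1) +
          cancelLen g.toWord ω.1 = cancelLen g.toWord ω.1 := by omega
      rw [harg] at e1
      rw [e0, e1]
      intro hcon
      apply cancelLen_max g.toWord ω.1 hklt
      subst hidx
      rw [List.getElem?_eq_getElem (by omega), hcon, linv_linv]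
    · have e0 : actSeq g ω n =
          ω.1 (n - (g.toWord.length - cancelLen g.toWord ω.1) +
            cancelLen g.toWord ω.1) := dif_neg h0
      have e1 : actSeq g ω (n + 1) =
          ω.1 (n + 1 - (g.toWord.length - cancelLen g.toWord ω.1) +
            cancelLen g.toWord ω.1) := dif_neg (by omega)
      have harg : n + 1 - (g.toWord.length - cancelLen g.toWord ω.1) +
          cancelLen g.toWord ω.1 =
          (n - (g.toWord.length - cancelLen g.toWord ω.1) + cancelLen g.toWord ω.1) + 1 := by
        omega
      rw [e0, e1, harg]
      exact ω.2 _

/-- The boundary action of `F` on `∂F`: `g · ω` is the free reduction of the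
concatenation of the reduced word of `g` with `ω`. -/
def bact {m : ℕ} (g : FreeGroup (Fin m)) (ω : Boundary m) : Boundary m :=
  ⟨actSeq g ω, isRedSeq_actSeq g ω⟩



/-- The boundary points sharing the first `n` letters with `ω₀`. -/
def cyl {m : ℕ} (n : ℕ) (ω₀ : Boundary m) : Set (Boundary m) :=
  {ω | ∀ i < n, ω.1 i = ω₀.1 i}

/-- The first `n` letters of a boundary point. -/
def restr {m : ℕ} (n : ℕ) (ω : Boundary m) : Fin n → Letter m := fun i => ω.1 i

/-- The shift map deleting the first `p` letters. -/
def shift {m : ℕ} (p : ℕ) (ω : Boundary m) : Boundary m :=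
  ⟨fun i => ω.1 (i + p), fun n => by
    have h := ω.2 (n + p)
    rwa [show n + p + 1 = n + 1 + p by omega] at h⟩

/-- The first `p` letters of `ζ` followed by `ω`, when `ω` starts with the letter of `ζ` at
position `p`; the value is `ζ` otherwise. -/
def glue {m : ℕ} (p : ℕ) (ζ ω : Boundary m) : Boundary m :=
  ⟨fun i => if ω.1 0 = ζ.1 p ∧ p ≤ i then ω.1 (i - p) else ζ.1 i, fun n => by
    by_cases h : ω.1 0 = ζ.1 p
    · rcases lt_trichotomy (n + 1) p with hn | hn | hn
      · simpa [show ¬ p ≤ n + 1 by omega, show ¬ p ≤ n by omega] using ζ.2 n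
      · subst hn
        simpa [h] using ζ.2 n
      · simpa [h, show p ≤ n + 1 by omega, show p ≤ n by omega,
          show n + 1 - p = n - p + 1 by omega] using ω.2 (n - p)
    · simpa [h] using ζ.2 n⟩

theorem glue_apply_of_lt {m : ℕ} {p i : ℕ} (ζ ω : Boundary m) (hi : i < p) :
    (glue p ζ ω).1 i = ζ.1 i := by
  simp [glue, show ¬ p ≤ i by omega]

theorem glue_apply_of_le {m : ℕ} {p i : ℕ} {ζ ω : Boundary m} (h : ω.1 0 = ζ.1 p) (hi : p ≤ i) :
    (glue p ζ ω).1 i = ω.1 (i - p) := by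
  simp [glue, h, hi]

theorem glue_shift {m : ℕ} {p : ℕ} {ζ η : Boundary m} (hη : η ∈ cyl (p + 1) ζ) :
    glue p ζ (shift p η) = η := by
  have h0 : (shift p η).1 0 = ζ.1 p := by simpa [shift] using hη p (by omega)
  apply Subtype.ext
  funext i
  by_cases hi : p ≤ i
  · rw [glue_apply_of_le h0 hi]
    simp [shift, hi]
  · rw [glue_apply_of_lt _ _ (by omega), hη i (by omega)]

theorem measurable_coord {m : ℕ} (i : ℕ) : Measurable fun ω : Boundary m => ω.1 i :=
  (measurable_pi_apply i).comp measurable_subtype_coe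

theorem measurable_restr {m : ℕ} (n : ℕ) : Measurable (restr (m := m) n) :=
  measurable_pi_lambda _ fun i => measurable_coord i

theorem measurable_shift {m : ℕ} (p : ℕ) : Measurable (shift (m := m) p) :=
  Measurable.subtype_mk (measurable_pi_lambda _ fun i => measurable_coord (i + p))

theorem measurable_glue {m : ℕ} (p : ℕ) (ζ : Boundary m) : Measurable (glue p ζ) := by
  refine Measurable.subtype_mk (measurable_pi_lambda _ fun i => ?_)
  refine Measurable.ite ?_ (measurable_coord _) measurable_const
  exact (measurable_coord 0 (measurableSet_singleton (ζ.1 p))).inter (MeasurableSet.const (p ≤ i))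

theorem cyl_eq_preimage_restr {m : ℕ} (n : ℕ) (ω₀ : Boundary m) :
    cyl n ω₀ = restr n ⁻¹' {restr n ω₀} := by
  ext ω
  simp only [cyl, restr, Set.mem_ofPred_eq, Set.mem_preimage, Set.mem_singleton_iff, funext_iff]
  exact ⟨fun h i => h i i.2, fun h i hi => h ⟨i, hi⟩⟩

theorem measurableSet_cyl {m : ℕ} (n : ℕ) (ω₀ : Boundary m) : MeasurableSet (cyl n ω₀) := by
  rw [cyl_eq_preimage_restr]
  exact measurable_restr n (measurableSet_singleton _)

theorem self_mem_cyl {m : ℕ} (n : ℕ) (ω : Boundary m) : ω ∈ cyl n ω := fun _ _ => rfl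

theorem preimage_restr_eq_empty_or_cyl {m : ℕ} (n : ℕ) (t : Fin n → Letter m) :
    restr n ⁻¹' {t} = ∅ ∨ ∃ ω₀, restr n ⁻¹' {t} = cyl n ω₀ := by
  rcases Set.eq_empty_or_nonempty (restr n ⁻¹' {t}) with h | ⟨ω₀, h⟩
  · exact Or.inl h
  · refine Or.inr ⟨ω₀, ?_⟩
    rw [cyl_eq_preimage_restr, show restr n ω₀ = t from h]

theorem isPiSystem_cyl {m : ℕ} :
    IsPiSystem {s : Set (Boundary m) | ∃ n ω₀, s = cyl (n + 1) ω₀} := by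
  rintro _ ⟨a, α, rfl⟩ _ ⟨b, β, rfl⟩ ⟨ω, hα, hβ⟩
  refine ⟨max a b, ω, Set.ext fun η => ⟨fun h i hi => ?_, fun h => ⟨fun i hi => ?_, fun i hi => ?_⟩⟩⟩
  · rcases le_total a b with hab | hab
    · rw [h.2 i (by omega), hβ i (by omega)]
    · rw [h.1 i (by omega), hα i (by omega)]
  · rw [h i (by omega), hα i hi]
  · rw [h i (by omega), hβ i hi]

theorem generateFrom_cyl {m : ℕ} :
    (inferInstance : MeasurableSpace (Boundary m)) =
      MeasurableSpace.generateFrom {s | ∃ n ω₀, s = cyl (n + 1) ω₀} := by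
  apply le_antisymm
  · set G := MeasurableSpace.generateFrom {s : Set (Boundary m) | ∃ n ω₀, s = cyl (n + 1) ω₀}
    have hcoord : ∀ i, Measurable[G] fun ω : Boundary m => ω.1 i := by
      intro i
      refine @measurable_to_countable' _ _ _ _ G _ fun x => ?_
      have : (fun ω : Boundary m => ω.1 i) ⁻¹' {x} =
          ⋃ t : {t : Fin (i + 1) → Letter m // t (Fin.last i) = x}, restr (i + 1) ⁻¹' {t.1} := by
        ext ω
        simp only [Set.mem_preimage, Set.mem_singleton_iff, Set.mem_iUnion]
        constructor
        · exact fun h => ⟨⟨restr (i + 1) ω, h⟩, rfl⟩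
        · rintro ⟨t, ht⟩
          rw [← t.2, ← ht]
          rfl
      rw [this]
      refine MeasurableSet.iUnion fun t => ?_
      rcases preimage_restr_eq_empty_or_cyl (i + 1) t.1 with h | ⟨ω₀, h⟩
      · rw [h]
        exact @MeasurableSet.empty _ G
      · rw [h]
        exact MeasurableSpace.measurableSet_generateFrom ⟨i, ω₀, rfl⟩
    have hval : Measurable[G] (Subtype.val : Boundary m → ℕ → Letter m) :=
      @measurable_pi_lambda _ _ _ G _ _ hcoord
    exact hval.comap_le
  · refine MeasurableSpace.generateFrom_le ?_
    rintro _ ⟨n, ω₀, rfl⟩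
    exact measurableSet_cyl _ _

theorem chain_rel_iff {m : ℕ} (a b : Letter m) : (a.1 = b.1 → a.2 = b.2) ↔ b ≠ linv a := by
  rcases a with ⟨a, s⟩
  rcases b with ⟨b, t⟩
  cases s <;> cases t <;> simp [linv, eq_comm]

theorem isReduced_ofFn {m : ℕ} (ω : Boundary m) (n : ℕ) :
    FreeGroup.IsReduced (List.ofFn fun i : Fin n => ω.1 i) := by
  refine List.isChain_iff_getElem.2 fun i hi => ?_
  rw [chain_rel_iff]
  simpa using ω.2 i

theorem toWord_trunc {m : ℕ} (ω : Boundary m) (n : ℕ) :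
    (trunc ω n).toWord = List.ofFn fun i : Fin n => ω.1 i := by
  rw [trunc, FreeGroup.toWord_mk, (isReduced_ofFn ω n).reduce_eq]

theorem wlen_trunc {m : ℕ} (ω : Boundary m) (n : ℕ) : wlen (trunc ω n) = n := by
  simp [wlen, toWord_trunc]

theorem cylinder_trunc {m : ℕ} (ω₀ : Boundary m) (n : ℕ) :
    cylinder (trunc ω₀ n) = cyl n ω₀ := by
  ext ω
  rw [_root_.cylinder, Set.mem_ofPred_eq, wlen_trunc, ← FreeGroup.toWord_inj, toWord_trunc, toWord_trunc,
    List.ofFn_injective.eq_iff, cyl_eq_preimage_restr]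
  rfl

theorem exists_measure_cyl_diff_lt {m : ℕ} (μ : Measure (Boundary m)) [IsFiniteMeasure μ]
    {W : Set (Boundary m)} (hW : MeasurableSet W) (hW0 : μ W ≠ 0) {ε : ℝ≥0∞} (hε : ε ≠ 0) :
    ∃ n ω₀, μ (cyl (n + 1) ω₀ \ W) < ε * μ (cyl (n + 1) ω₀) := by
  by_contra! hcon
  have : SecondCountableTopology (Boundary m) :=
    TopologicalSpace.Subtype.secondCountableTopology _
  have : TopologicalSpace.MetrizableSpace (Boundary m) :=
    TopologicalSpace.metrizableSpace_of_t3_secondCountable _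
  obtain ⟨K, hKW, hK, hK0⟩ := hW.exists_lt_isClosed_of_ne_top (measure_ne_top μ W)
    (pos_iff_ne_zero.2 hW0)
  set U : ℕ → Set (Boundary m) := fun n => restr (n + 1) ⁻¹' (restr (n + 1) '' K) with hU
  have hKU : ∀ n, K ⊆ U n := fun n => Set.subset_preimage_image _ _
  have hUm : ∀ n, MeasurableSet (U n) := fun n =>
    measurable_restr _ (Set.toFinite _).measurableSet
  have hle : ∀ n, ε * μ (U n) ≤ μ (U n \ K) := by
    intro n
    have hfin := Set.toFinite (restr (n + 1) '' K)
    have hUe : U n = restr (n + 1) ⁻¹' (hfin.toFinset : Set (Fin (n + 1) → Letter m)) := by simp [hU]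
    have hmeas : ∀ y ∈ hfin.toFinset, MeasurableSet (restr (m := m) (n + 1) ⁻¹' {y}) := fun y _ =>
      measurable_restr _ (measurableSet_singleton y)
    have h2 : μ (U n \ K) = μ.restrict Kᶜ (U n) := by
      rw [Measure.restrict_apply (hUm n), Set.sdiff_eq]
    rw [h2, hUe, ← sum_measure_preimage_singleton _ hmeas, ← sum_measure_preimage_singleton _ hmeas,
      Finset.mul_sum]
    refine Finset.sum_le_sum fun t ht => ?_
    rw [Measure.restrict_apply (hmeas t ht), ← Set.sdiff_eq]
    rcases preimage_restr_eq_empty_or_cyl (n + 1) t with h | ⟨ω₀, h⟩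
    · simp [h]
    · rw [h]
      exact (hcon n ω₀).trans (measure_mono (Set.sdiff_subset_sdiff_right hKW))
  have hanti : Antitone fun n => U n \ K := by
    refine antitone_nat_of_succ_le fun n ω hω => ⟨?_, hω.2⟩
    obtain ⟨κ, hκ, h⟩ := hω.1
    exact ⟨κ, hκ, funext fun i => congrFun h i.castSucc⟩
  have hinter : ⋂ n, U n \ K = ∅ := by
    rw [Set.eq_empty_iff_forall_notMem]
    intro ω hω
    rw [Set.mem_iInter] at hω
    have hn := fun n => (hω n).1
    choose κ hκ h using hn
    refine (hω 0).2 (hK.mem_of_tendsto (b := atTop) (f := κ) ?_ (Eventually.of_forall hκ))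
    rw [tendsto_subtype_rng, tendsto_pi_nhds]
    intro i
    refine tendsto_const_nhds.congr' ?_
    filter_upwards [eventually_ge_atTop i] with n hin
    exact (congrFun (h n) ⟨i, by omega⟩).symm
  have hlim : Tendsto (fun n => μ (U n \ K)) atTop (𝓝 0) := by
    have := tendsto_measure_iInter_atTop (μ := μ)
      (fun n => ((hUm n).diff hK.measurableSet).nullMeasurableSet) hanti ⟨0, measure_ne_top _ _⟩
    rwa [hinter, measure_empty] at this
  have : ε * μ K ≤ 0 := ge_of_tendsto' hlim fun n =>
    (mul_le_mul_right (measure_mono (hKU n)) ε).trans (hle n)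
  exact (mul_ne_zero hε hK0.ne') (le_antisymm this bot_le)

theorem measure_cyl_succ {m : ℕ} {μ : Measure (Boundary m)}
    (hμ : ∀ g : FreeGroup (Fin m), g ≠ 1 →
      μ (cylinder g) = ((2 * m * (2 * m - 1) ^ (wlen g - 1) : ℕ) : ℝ≥0∞)⁻¹)
    (n : ℕ) (ω₀ : Boundary m) :
    μ (cyl (n + 1) ω₀) = ((2 * m * (2 * m - 1) ^ n : ℕ) : ℝ≥0∞)⁻¹ := by
  have h1 : trunc ω₀ (n + 1) ≠ 1 := by
    intro h
    have := wlen_trunc ω₀ (n + 1)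
    simp [h, wlen] at this
  rw [← cylinder_trunc, hμ _ h1, wlen_trunc, Nat.add_sub_cancel]

/-- Deleting the first `p` letters multiplies the measure by `(2m - 1) ^ p` on cylinders of
length `p + 1`. -/
theorem pow_mul_measure_cyl_inter_preimage_shift {m : ℕ} (hm : 0 < m) {μ : Measure (Boundary m)}
    [IsFiniteMeasure μ]
    (hμ : ∀ n ω₀, μ (cyl (n + 1) ω₀) = ((2 * m * (2 * m - 1) ^ n : ℕ) : ℝ≥0∞)⁻¹)
    (p : ℕ) (ζ : Boundary m) {A : Set (Boundary m)} (hA : MeasurableSet A) :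
    ((2 * m - 1 : ℕ) : ℝ≥0∞) ^ p * μ (cyl (p + 1) ζ ∩ shift p ⁻¹' A) =
      μ (A ∩ cyl 1 (shift p ζ)) := by
  set q : ℕ := 2 * m - 1 with hq
  have hq0 : (q : ℝ≥0∞) ≠ 0 := by
    rw [Nat.cast_ne_zero]
    omega
  have hscale : ∀ n, (q : ℝ≥0∞) ^ p * ((2 * m * q ^ (p + n) : ℕ) : ℝ≥0∞)⁻¹ =
      ((2 * m * q ^ n : ℕ) : ℝ≥0∞)⁻¹ := by
    intro n
    have hp0 : (q : ℝ≥0∞) ^ p ≠ 0 := pow_ne_zero _ hq0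
    have hpt : (q : ℝ≥0∞) ^ p ≠ ∞ := by finiteness
    rw [show 2 * m * q ^ (p + n) = q ^ p * (2 * m * q ^ n) by ring, Nat.cast_mul,
      ENNReal.mul_inv (Or.inr (by finiteness)) (Or.inl (by rw [Nat.cast_pow]; exact hpt)),
      ← mul_assoc, Nat.cast_pow, ENNReal.mul_inv_cancel hp0 hpt, one_mul]
  have hcyl : ∀ n ω₁, (q : ℝ≥0∞) ^ p * μ (cyl (p + 1) ζ ∩ shift p ⁻¹' cyl (n + 1) ω₁) =
      μ (cyl (n + 1) ω₁ ∩ cyl 1 (shift p ζ)) := by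
    intro n ω₁
    by_cases h : ω₁.1 0 = ζ.1 p
    · have h1 : cyl (p + 1) ζ ∩ shift p ⁻¹' cyl (n + 1) ω₁ = cyl (p + n + 1) (glue p ζ ω₁) := by
        ext η
        constructor
        · rintro ⟨h2, h3⟩ i hi
          by_cases hip : p ≤ i
          · rw [glue_apply_of_le h hip, ← h3 (i - p) (by omega)]
            simp [shift, hip]
          · rw [glue_apply_of_lt _ _ (by omega), h2 i (by omega)]
        · refine fun h2 => ⟨fun i hi => ?_, fun i hi => ?_⟩
          · rw [h2 i (by omega)]
            rcases Nat.lt_succ_iff_lt_or_eq.1 hi with hip | rfl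
            · rw [glue_apply_of_lt _ _ hip]
            · rw [glue_apply_of_le h le_rfl, Nat.sub_self, h]
          · have h3 := h2 (i + p) (by omega)
            rwa [glue_apply_of_le h (by omega), Nat.add_sub_cancel] at h3
      have h4 : cyl (n + 1) ω₁ ∩ cyl 1 (shift p ζ) = cyl (n + 1) ω₁ := by
        refine Set.inter_eq_left.2 fun η hη i hi => ?_
        obtain rfl : i = 0 := by omega
        rw [hη 0 (by omega), h]
        simp [shift]
      rw [h1, h4, hμ, hμ, hscale]
    · have h1 : cyl (p + 1) ζ ∩ shift p ⁻¹' cyl (n + 1) ω₁ = ∅ := by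
        refine Set.eq_empty_of_forall_notMem fun η hη => h ?_
        rw [← hη.2 0 (by omega), ← hη.1 p (by omega)]
        simp [shift]
      have h2 : cyl (n + 1) ω₁ ∩ cyl 1 (shift p ζ) = ∅ := by
        refine Set.eq_empty_of_forall_notMem fun η hη => h ?_
        rw [← hη.1 0 (by omega), hη.2 0 (by omega)]
        simp [shift]
      rw [h1, h2, measure_empty, mul_zero]
  have hfin : IsFiniteMeasure ((q : ℝ≥0∞) ^ p • (μ.restrict (cyl (p + 1) ζ)).map (shift p)) :=
    Measure.smul_finite _ (by finiteness)
  have key : (q : ℝ≥0∞) ^ p • (μ.restrict (cyl (p + 1) ζ)).map (shift p) =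
      μ.restrict (cyl 1 (shift p ζ)) := by
    refine ext_of_generate_finite _ generateFrom_cyl isPiSystem_cyl ?_ ?_
    · rintro _ ⟨n, ω₁, rfl⟩
      rw [Measure.smul_apply, Measure.map_apply (measurable_shift p) (measurableSet_cyl _ _),
        Measure.restrict_apply (measurable_shift p (measurableSet_cyl _ _)),
        Measure.restrict_apply (measurableSet_cyl _ _), smul_eq_mul, Set.inter_comm, hcyl]
    · rw [Measure.smul_apply, Measure.map_apply (measurable_shift p) MeasurableSet.univ,
        Set.preimage_univ, Measure.restrict_apply_univ, Measure.restrict_apply_univ, smul_eq_mul,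
        hμ p, show (1 : ℕ) = 0 + 1 from rfl, hμ 0, ← hscale 0, add_zero]
  rw [← Measure.restrict_apply hA, ← key, Measure.smul_apply,
    Measure.map_apply (measurable_shift p) hA,
    Measure.restrict_apply (measurable_shift p hA), smul_eq_mul, Set.inter_comm]

theorem invRev_getElem? {m : ℕ} (ζ : Boundary m) {p i : ℕ} (hi : i < p) :
    (FreeGroup.invRev (List.ofFn fun j : Fin p => ζ.1 j))[p - 1 - i]? = some (linv (ζ.1 i)) := by
  rw [FreeGroup.invRev, List.getElem?_reverse (by simp; omega)]
  simp [linv, show p - 1 - (p - 1 - i) = i by omega, hi]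

/-- The element with reduced word `u v⁻¹`, where `u` and `v` are the initial segments of `ξ` and
`ζ` of lengths `r` and `p`, replaces the prefix `v` by `u`. -/
theorem bact_glue {m : ℕ} {k : FreeGroup (Fin m)} {ζ ξ ω : Boundary m} {p r : ℕ}
    (hk : k.toWord = (List.ofFn fun i : Fin r => ξ.1 i) ++
      FreeGroup.invRev (List.ofFn fun i : Fin p => ζ.1 i))
    (hζ : ω.1 0 = ζ.1 p) (hξ : ω.1 0 = ξ.1 r) :
    bact k (glue p ζ ω) = glue r ξ ω := by
  have hlen : k.toWord.length = r + p := by simp [hk]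
  have hget : ∀ i < r, k.toWord[i]? = some (ξ.1 i) := by
    intro i hi
    rw [hk, List.getElem?_append_left (by simpa using hi)]
    simp [hi]
  have hcancel : cancelLen k.toWord (glue p ζ ω).1 = p := by
    apply le_antisymm
    · by_contra! hlt
      obtain ⟨h1, h2⟩ := cancelLen_spec k.toWord (glue p ζ ω).1
      have h3 := h2 p hlt
      rw [hlen] at h1 h3
      rw [hget _ (by omega), Option.some_inj, glue_apply_of_le hζ le_rfl, Nat.sub_self, hξ] at h3
      have h4 := ξ.2 (r - 1)
      rw [show r - 1 + 1 = r by omega] at h4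
      apply h4
      rw [show r - 1 = r + p - 1 - p by omega, h3, linv_linv]
    · refine le_csSup ⟨k.toWord.length, fun x hx => hx.1⟩ ⟨by omega, fun i hi => ?_⟩
      rw [hlen, hk, List.getElem?_append_right (by simp; omega), List.length_ofFn,
        show r + p - 1 - i - r = p - 1 - i by omega, invRev_getElem? ζ hi,
        glue_apply_of_lt _ _ hi]
  apply Subtype.ext
  funext i
  change actSeq k (glue p ζ ω) i = _
  by_cases hi : i < r
  · rw [actSeq, dif_pos (by omega), glue_apply_of_lt _ _ hi]
    have h1 := hget i hi
    rw [List.getElem?_eq_getElem (by omega)] at h1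
    exact Option.some_inj.1 h1
  · rw [actSeq, dif_neg (by omega), hcancel, hlen, glue_apply_of_le hζ (by omega),
      glue_apply_of_le hξ (by omega)]
    rw [show i - (r + p - p) + p - p = i - r by omega]

theorem bact_one {m : ℕ} (ω : Boundary m) : bact 1 ω = ω := by
  apply Subtype.ext
  funext i
  have h : cancelLen (1 : FreeGroup (Fin m)).toWord ω.1 = 0 := by
    have := (cancelLen_spec (1 : FreeGroup (Fin m)).toWord ω.1).1
    simpa using this
  change actSeq 1 ω i = _
  rw [actSeq, dif_neg (by simp), h]
  simp

theorem measure_inter_bact_image_ne_zero {m : ℕ} (hm : 0 < m) {μ : Measure (Boundary m)}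
    [IsFiniteMeasure μ]
    (hμ : ∀ n ω₀, μ (cyl (n + 1) ω₀) = ((2 * m * (2 * m - 1) ^ n : ℕ) : ℝ≥0∞)⁻¹)
    {W : Set (Boundary m)} (hW : MeasurableSet W) {k : FreeGroup (Fin m)} {ω₀ ζ ξ : Boundary m}
    {n p r : ℕ} (hnp : n ≤ p) (hpr : p ≤ r) (hζ : ζ ∈ cyl n ω₀) (hξ : ξ ∈ cyl n ω₀)
    (hζξ : ζ.1 p = ξ.1 r)
    (hk : k.toWord = (List.ofFn fun i : Fin r => ξ.1 i) ++
      FreeGroup.invRev (List.ofFn fun i : Fin p => ζ.1 i))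
    (hlt : 2 * ((2 * m - 1 : ℕ) : ℝ≥0∞) ^ r * μ (cyl n ω₀ \ W) < ((2 * m : ℕ) : ℝ≥0∞)⁻¹) :
    μ (W ∩ bact k '' W) ≠ 0 := by
  set q : ℕ := 2 * m - 1 with hq
  have hbad : ∀ s χ, n ≤ s → s ≤ r → χ ∈ cyl n ω₀ →
      μ (glue s χ ⁻¹' Wᶜ ∩ cyl 1 (shift s χ)) ≤ (q : ℝ≥0∞) ^ r * μ (cyl n ω₀ \ W) := by
    intro s χ hns hsr hχ
    rw [← pow_mul_measure_cyl_inter_preimage_shift hm hμ s χ (measurable_glue s χ hW.compl)]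
    refine mul_le_mul' (pow_le_pow_right₀ ?_ hsr) (measure_mono ?_)
    · rw [Nat.one_le_cast]
      omega
    · rintro η ⟨h1, h2⟩
      refine ⟨fun i hi => ?_, ?_⟩
      · rw [h1 i (by omega), hχ i hi]
      · rw [Set.mem_preimage, Set.mem_preimage, glue_shift h1] at h2
        exact h2
  have hD : cyl 1 (shift p ζ) = cyl 1 (shift r ξ) := by
    ext η
    simp [cyl, shift, hζξ]
  set E : Set (Boundary m) := glue p ζ ⁻¹' W ∩ glue r ξ ⁻¹' W
  have hEm : MeasurableSet E := (measurable_glue p ζ hW).inter (measurable_glue r ξ hW)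
  have hEpos : μ (E ∩ cyl 1 (shift r ξ)) ≠ 0 := by
    intro h0
    have hcover : cyl 1 (shift r ξ) ⊆ (E ∩ cyl 1 (shift r ξ)) ∪
        ((glue p ζ ⁻¹' Wᶜ ∩ cyl 1 (shift p ζ)) ∪ (glue r ξ ⁻¹' Wᶜ ∩ cyl 1 (shift r ξ))) := by
      intro η hη
      rw [hD]
      by_cases h1 : glue p ζ η ∈ W
      · by_cases h2 : glue r ξ η ∈ W
        · exact Or.inl ⟨⟨h1, h2⟩, hη⟩
        · exact Or.inr (Or.inr ⟨h2, hη⟩)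
      · exact Or.inr (Or.inl ⟨h1, hη⟩)
    have hle : μ (cyl 1 (shift r ξ)) ≤ 2 * (q : ℝ≥0∞) ^ r * μ (cyl n ω₀ \ W) := by
      refine (measure_mono hcover).trans ((measure_union_le _ _).trans ?_)
      rw [h0, zero_add, mul_assoc, two_mul]
      exact (measure_union_le _ _).trans
        (add_le_add (hbad p ζ hnp hpr hζ) (hbad r ξ (hnp.trans hpr) le_rfl hξ))
    have h1 : μ (cyl 1 (shift r ξ)) = ((2 * m : ℕ) : ℝ≥0∞)⁻¹ := by
      simpa using hμ 0 (shift r ξ)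
    exact absurd hlt (not_lt.2 (h1 ▸ hle))
  rw [← pow_mul_measure_cyl_inter_preimage_shift hm hμ r ξ hEm] at hEpos
  refine fun h0 => hEpos ?_
  rw [measure_mono_null ?_ h0, mul_zero]
  rintro η ⟨h1, h2, h3⟩
  rw [Set.mem_preimage, glue_shift h1] at h3
  have h4 : (shift r η).1 0 = ξ.1 r := by simpa [shift] using h1 r (by omega)
  refine ⟨h3, glue p ζ (shift r η), h2, ?_⟩
  rw [bact_glue hk (h4.trans hζξ.symm) h4, glue_shift h1]

/-- The boundary point `L b b b ⋯`. -/
def ofList {m : ℕ} (L : List (Letter m)) (b : Letter m) (h : FreeGroup.IsReduced (L ++ [b])) :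
    Boundary m :=
  ⟨fun i => L.getD i b, fun n => by
    rw [FreeGroup.IsReduced, List.isChain_iff_getElem] at h
    rcases lt_trichotomy (n + 1) L.length with hn | hn | hn
    · have h1 := h n (by simp; omega)
      rw [chain_rel_iff] at h1
      simpa [List.getElem_append, hn, show n < L.length by omega] using h1
    · have h1 := h n (by simp; omega)
      rw [chain_rel_iff] at h1
      simpa [List.getElem_append, hn, show n < L.length by omega] using h1
    · simp [hn.le, show L.length ≤ n by omega, linv, Prod.ext_iff]⟩

theorem ofList_apply_length {m : ℕ} (L : List (Letter m)) (b : Letter m)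
    (h : FreeGroup.IsReduced (L ++ [b])) : (ofList L b h).1 L.length = b := by
  simp [ofList]

theorem ofFn_ofList {m : ℕ} (L : List (Letter m)) (b : Letter m)
    (h : FreeGroup.IsReduced (L ++ [b])) :
    (List.ofFn fun i : Fin L.length => (ofList L b h).1 i) = L := by
  simp [ofList]

theorem ofList_mem_cyl {m : ℕ} {n : ℕ} {ω₀ : Boundary m} {L : List (Letter m)} {b : Letter m}
    (h : FreeGroup.IsReduced (L ++ [b])) (hL : (List.ofFn fun i : Fin n => ω₀.1 i) <+: L) :
    ofList L b h ∈ cyl n ω₀ := by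
  obtain ⟨L', rfl⟩ := hL
  intro i hi
  simp [ofList, List.getElem?_append, hi]

theorem IsReduced.append {m : ℕ} {L₁ L₂ : List (Letter m)} (h₁ : FreeGroup.IsReduced L₁)
    (h₂ : FreeGroup.IsReduced L₂)
    (h : ∀ x ∈ L₁.getLast?, ∀ y ∈ L₂.head?, y ≠ linv x) : FreeGroup.IsReduced (L₁ ++ L₂) :=
  List.isChain_append.2 ⟨h₁, h₂, fun x hx y hy => (chain_rel_iff x y).2 (h x hx y hy)⟩

theorem exists_letter_notMem {m : ℕ} (hm : 2 ≤ m) (s : Finset (Letter m)) (hs : s.card ≤ 3) :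
    ∃ c, c ∉ s := by
  by_contra! h
  have h1 : s = Finset.univ := Finset.eq_univ_iff_forall.2 h
  rw [h1, Finset.card_univ] at hs
  simp at hs
  omega

/-- **Conservativity of the boundary action of a nontrivial normal subgroup.** -/
theorem normal_subgroup_boundary_action_conservative (m : ℕ) (hm : 2 ≤ m)
    (μ : Measure (Boundary m)) [IsProbabilityMeasure μ]
    (hμ : ∀ g : FreeGroup (Fin m), g ≠ 1 →
      μ (cylinder g) = ((2 * m * (2 * m - 1) ^ (wlen g - 1) : ℕ) : ℝ≥0∞)⁻¹)
    (H : Subgroup (FreeGroup (Fin m))) (hnorm : H.Normal) (hbot : H ≠ ⊥) :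
    ∀ W : Set (Boundary m), MeasurableSet W →
      (∀ h h' : H, h ≠ h' →
        μ (bact (h : FreeGroup (Fin m)) '' W ∩ bact (h' : FreeGroup (Fin m)) '' W) = 0) →
      μ W = 0 := by
  intro W hW hwand
  by_contra hW0
  have hc := measure_cyl_succ hμ
  obtain ⟨h, hH, h1⟩ := H.bot_or_exists_ne_one.resolve_left hbot
  have hw : h.toWord ≠ [] := by simpa using h1
  set q : ℕ := 2 * m - 1 with hq
  have hq0 : (q : ℝ≥0∞) ≠ 0 := by
    rw [Nat.cast_ne_zero]
    omega
  set l := h.toWord.length with hl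
  have hε : (2 * (q : ℝ≥0∞) ^ (l + 2))⁻¹ ≠ 0 := ENNReal.inv_ne_zero.2 (by finiteness)
  obtain ⟨n, ω₀, hlt⟩ := exists_measure_cyl_diff_lt μ hW hW0 hε
  obtain ⟨c, hcmem⟩ := exists_letter_notMem hm
    {linv (ω₀.1 n), linv (h.toWord.head hw), h.toWord.getLast hw} Finset.card_le_three
  obtain ⟨b, hbmem⟩ := exists_letter_notMem hm {linv c, linv (h.toWord.getLast hw)}
    (Finset.card_le_two.trans (by norm_num))
  simp only [Finset.mem_insert, Finset.mem_singleton, not_or] at hcmem hbmem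
  obtain ⟨hc1, hc2, hc3⟩ := hcmem
  set G := List.ofFn fun i : Fin (n + 1) => ω₀.1 i with hG
  have hGlen : G.length = n + 1 := by simp [hG]
  have hγ : FreeGroup.IsReduced (G ++ [c]) := by
    refine IsReduced.append (isReduced_ofFn ω₀ _) FreeGroup.IsReduced.singleton ?_
    intro x hx y hy
    obtain rfl : c = y := by simpa using hy
    obtain rfl : ω₀.1 n = x := by simpa [hG, List.getLast?_eq_getElem?, -List.ofFn_succ] using hx
    exact hc1
  have hγh : FreeGroup.IsReduced (G ++ [c] ++ h.toWord) := by
    refine IsReduced.append hγ FreeGroup.isReduced_toWord ?_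
    intro x hx y hy e
    obtain rfl : c = x := by simpa using hx
    rw [List.head?_eq_some_head hw, Option.mem_some] at hy
    exact hc2 (by rw [hy, e, linv_linv])
  have hlast : ∀ x ∈ (G ++ [c] ++ h.toWord).getLast?, x = h.toWord.getLast hw := by
    intro x hx
    rw [List.getLast?_append_of_ne_nil _ hw, List.getLast?_eq_some_getLast hw,
      Option.mem_some] at hx
    exact hx.symm
  have hγb : FreeGroup.IsReduced (G ++ [c] ++ [b]) := by
    refine IsReduced.append hγ FreeGroup.IsReduced.singleton ?_
    simpa using hbmem.1
  have hγhb : FreeGroup.IsReduced (G ++ [c] ++ h.toWord ++ [b]) := by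
    refine IsReduced.append hγh FreeGroup.IsReduced.singleton fun x hx y hy => ?_
    obtain rfl : b = y := by simpa using hy
    rw [hlast x hx]
    exact hbmem.2
  have hk : FreeGroup.IsReduced (G ++ [c] ++ h.toWord ++ FreeGroup.invRev (G ++ [c])) := by
    refine IsReduced.append hγh ?_ fun x hx y hy e => hc3 ?_
    · rw [FreeGroup.isReduced_iff_reduce_eq, FreeGroup.reduce_invRev, hγ.reduce_eq]
    · obtain rfl : linv c = y := by simpa [FreeGroup.invRev, linv] using hy
      rw [hlast x hx] at e
      rw [← linv_linv c, e, linv_linv]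
  set k : FreeGroup (Fin m) := FreeGroup.mk (G ++ [c]) * h * (FreeGroup.mk (G ++ [c]))⁻¹
  have hkH : k ∈ H := hnorm.conj_mem h hH _
  have hkw : k.toWord = G ++ [c] ++ h.toWord ++ FreeGroup.invRev (G ++ [c]) := by
    rw [← hk.reduce_eq, ← FreeGroup.toWord_mk, ← FreeGroup.mul_mk, ← FreeGroup.mul_mk,
      FreeGroup.mk_toWord, ← FreeGroup.inv_mk]
  have hk1 : (1 : FreeGroup (Fin m)) ≠ k := by
    intro e
    rw [← e] at hkw
    simp at hkw
  have hnull := hwand ⟨1, H.one_mem⟩ ⟨k, hkH⟩ (fun e => hk1 (congrArg Subtype.val e))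
  have himg : bact (1 : FreeGroup (Fin m)) '' W = W := by simp [bact_one]
  rw [himg] at hnull
  refine measure_inter_bact_image_ne_zero (by omega) hc hW (n := n + 1)
    (p := (G ++ [c]).length) (r := (G ++ [c] ++ h.toWord).length)
    (by simp [hGlen]) (by simp) (ofList_mem_cyl hγb (List.prefix_append _ _))
    (ofList_mem_cyl hγhb ((List.prefix_append G [c]).trans (List.prefix_append _ _)))
    ?_ ?_ ?_ hnull
  · rw [ofList_apply_length, ofList_apply_length]
  · rw [ofFn_ofList, ofFn_ofList, hkw]
  · have hr : (G ++ [c] ++ h.toWord).length = n + (l + 2) := by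
      simp [hGlen, ← hl]
      omega
    rw [hr]
    rw [hc n ω₀] at hlt
    have hK0 : 2 * (q : ℝ≥0∞) ^ (n + (l + 2)) ≠ 0 := mul_ne_zero two_ne_zero (pow_ne_zero _ hq0)
    have hKt : 2 * (q : ℝ≥0∞) ^ (n + (l + 2)) ≠ ∞ := by finiteness
    refine (ENNReal.mul_lt_mul_right hK0 hKt hlt).trans_eq ?_
    have hn0 : (q : ℝ≥0∞) ^ n ≠ 0 := pow_ne_zero _ hq0
    have hnt : (q : ℝ≥0∞) ^ n ≠ ∞ := by finiteness
    have hl0 : 2 * (q : ℝ≥0∞) ^ (l + 2) ≠ 0 := mul_ne_zero two_ne_zero (pow_ne_zero _ hq0)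
    have hlt : 2 * (q : ℝ≥0∞) ^ (l + 2) ≠ ∞ := by finiteness
    rw [Nat.cast_mul (2 * m), Nat.cast_pow,
      ENNReal.mul_inv (Or.inr hnt) (Or.inr hn0)]
    calc _ = ((q : ℝ≥0∞) ^ n * ((q : ℝ≥0∞) ^ n)⁻¹) *
          ((2 * (q : ℝ≥0∞) ^ (l + 2)) * (2 * (q : ℝ≥0∞) ^ (l + 2))⁻¹) *
          ((2 * m : ℕ) : ℝ≥0∞)⁻¹ := by ring
      _ = _ := by
        rw [ENNReal.mul_inv_cancel hn0 hnt, ENNReal.mul_inv_cancel hl0 hlt, one_mul, one_mul]
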